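/- arXiv:2201.08159 — 3 statements merged into one kernel-verified Lean document; each statement's English description precedes it below -/
import Mathlib

section
/- Assume σ < -2 and p > -1-σ with a = (2+σ)/(1-p) = 1/2. Then there exists a positive C² solution u of -u''(x) = x^σ u(x)^p on (0,+∞) such that u - u_a changes sign infinitely many times near x = 0, the ratio u/u_a is bounded on (0,+∞), but u(x)/u_a(x) does not converge as x → 0⁺. -/
open Set Filter

/-- The explicit solution `u_a(x) = c_a x^a` with `a = (2+σ)/(1-p)` and
`c_a = (a(1-a))^{1/(p-1)}`. -/
noncomputable def uExplicit (p σ : ℝ) (x : ℝ) : ℝ :=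
  ((2 + σ) / (1 - p) * (1 - (2 + σ) / (1 - p))) ^ (1 / (p - 1)) * x ^ ((2 + σ) / (1 - p))

/-- `u` is a positive `C²` solution of `-u'' = x^σ u^p` on `(0,+∞)`. -/
def IsPosSol (p σ : ℝ) (u : ℝ → ℝ) : Prop :=
  (∀ x ∈ Set.Ioi (0 : ℝ), 0 < u x) ∧ ContDiffOn ℝ 2 u (Set.Ioi 0) ∧
  ∀ x ∈ Set.Ioi (0 : ℝ), -(deriv (deriv u) x) = x ^ σ * u x ^ p

/-- A bounded Lipschitz autonomous vector field has a global integral curve through each point. -/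
theorem exists_forall_hasDerivAt_of_lipschitzWith_of_bounded
    {E : Type*} [NormedAddCommGroup E] [NormedSpace ℝ E] [CompleteSpace E]
    {F : E → E} {K L : NNReal} (hF : LipschitzWith K F) (hL : ∀ x, ‖F x‖ ≤ L) (x₀ : E) :
    ∃ α : ℝ → E, α 0 = x₀ ∧ ∀ t, HasDerivAt α (F (α t)) t := by
  have hloc : ∀ n : ℕ, ∃ β : ℝ → E, β 0 = x₀ ∧
      ∀ t ∈ Ioo (-(n : ℝ)) n, HasDerivAt β (F (β t)) t := by
    intro n
    have h0 : (0 : ℝ) ∈ Icc (-(n : ℝ)) n := ⟨by simp, by simp⟩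
    have hPL : IsPicardLindelof (fun _ : ℝ => F) (⟨0, h0⟩ : Icc (-(n : ℝ)) n) x₀ (L * n) 0 L K :=
      { lipschitzOnWith := fun _ _ => hF.lipschitzOnWith
        continuousOn := fun _ _ => continuousOn_const
        norm_le := fun _ _ x _ => hL x
        mul_max_le := by simp }
    obtain ⟨β, hβ0, hβ⟩ := hPL.exists_eq_forall_mem_Icc_hasDerivWithinAt₀
    exact ⟨β, hβ0, fun t ht => (hβ t (Ioo_subset_Icc_self ht)).hasDerivAt (Icc_mem_nhds ht.1 ht.2)⟩
  choose β hβ0 hβ using hloc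
  have hagree : ∀ (n m : ℕ) (s : ℝ), |s| < n → |s| < m → β n s = β m s := by
    intro n m s hn hm
    have hr : |s| < min (n : ℝ) m := lt_min hn hm
    have hsub : ∀ k : ℕ, min (n : ℝ) m ≤ k →
        Ioo (-min (n : ℝ) m) (min (n : ℝ) m) ⊆ Ioo (-(k : ℝ)) k :=
      fun k hk => Ioo_subset_Ioo (neg_le_neg hk) hk
    have hpos : 0 < min (n : ℝ) m := (abs_nonneg s).trans_lt hr
    exact ODE_solution_unique_of_mem_Ioo (v := fun _ => F) (s := fun _ => univ)
      (fun _ _ => hF.lipschitzOnWith) (t₀ := 0) ⟨neg_lt_zero.2 hpos, hpos⟩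
      (fun t ht => ⟨hβ n t (hsub n (min_le_left _ _) ht), mem_univ _⟩)
      (fun t ht => ⟨hβ m t (hsub m (min_le_right _ _) ht), mem_univ _⟩)
      ((hβ0 n).trans (hβ0 m).symm) (abs_lt.1 hr)
  have hfloor : ∀ s : ℝ, |s| < ((⌊|s|⌋₊ + 1 : ℕ) : ℝ) := fun s => by
    push_cast
    exact Nat.lt_floor_add_one _
  refine ⟨fun s => β (⌊|s|⌋₊ + 1) s, hβ0 _, fun t => ?_⟩
  refine (hβ (⌊|t|⌋₊ + 1) t (abs_lt.1 (hfloor t))).congr_of_eventuallyEq ?_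
  filter_upwards [continuous_abs.continuousAt.eventually_lt_const (hfloor t)] with s hs
  exact hagree _ _ s (hfloor s) hs

theorem HasDerivAt.image_sub_le_mul_sub_of_le {f f' : ℝ → ℝ} {a C : ℝ}
    (hf : ∀ t, HasDerivAt f (f' t) t) (hC : ∀ t, a ≤ t → f' t ≤ C) {t : ℝ} (ht : a ≤ t) :
    f t - f a ≤ C * (t - a) := by
  refine (convex_Ici a).image_sub_le_mul_sub_of_deriv_le
    (fun x _ => (hf x).continuousAt.continuousWithinAt)
    (fun x _ => (hf x).differentiableAt.differentiableWithinAt) ?_ a self_mem_Ici t ht ht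
  intro x hx
  rw [(hf x).deriv]
  exact hC x (interior_subset hx)

section Potential

variable {g : ℝ → ℝ} {c : ℝ}

theorem hasDerivAt_integral_of_continuous (hg : Continuous g) (c x : ℝ) :
    HasDerivAt (fun x => ∫ s in c..x, g s) (g x) x :=
  intervalIntegral.integral_hasDerivAt_right (hg.intervalIntegrable _ _)
    (hg.stronglyMeasurableAtFilter _ _) hg.continuousAt

theorem strictMonoOn_integral_of_pos (hg : Continuous g) (hpos : ∀ x, c < x → 0 < g x) :
    StrictMonoOn (fun x => ∫ s in c..x, g s) (Ici c) := by
  refine strictMonoOn_of_deriv_pos (convex_Ici c)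
    (fun x _ => (hasDerivAt_integral_of_continuous hg c x).continuousAt.continuousWithinAt) ?_
  intro x hx
  rw [interior_Ici] at hx
  rw [(hasDerivAt_integral_of_continuous hg c x).deriv]
  exact hpos x hx

theorem strictAntiOn_integral_of_neg (hg : Continuous g) (hneg : ∀ x, x < c → g x < 0) :
    StrictAntiOn (fun x => ∫ s in c..x, g s) (Iic c) := by
  refine strictAntiOn_of_deriv_neg (convex_Iic c)
    (fun x _ => (hasDerivAt_integral_of_continuous hg c x).continuousAt.continuousWithinAt) ?_
  intro x hx
  rw [interior_Iic] at hx
  rw [(hasDerivAt_integral_of_continuous hg c x).deriv]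
  exact hneg x hx

theorem integral_pos_of_ne (hg : Continuous g) (hpos : ∀ x, c < x → 0 < g x)
    (hneg : ∀ x, x < c → g x < 0) {x : ℝ} (hx : x ≠ c) : 0 < ∫ s in c..x, g s := by
  rcases hx.lt_or_gt with h | h
  · simpa using strictAntiOn_integral_of_neg hg hneg (mem_Iic.2 h.le) self_mem_Iic h
  · simpa using strictMonoOn_integral_of_pos hg hpos self_mem_Ici (mem_Ici.2 h.le) h

theorem integral_nonneg_of_sign (hg : Continuous g) (hpos : ∀ x, c < x → 0 < g x)
    (hneg : ∀ x, x < c → g x < 0) (x : ℝ) : 0 ≤ ∫ s in c..x, g s := by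
  rcases eq_or_ne x c with rfl | h
  · simp
  · exact (integral_pos_of_ne hg hpos hneg h).le

theorem mem_Icc_of_integral_lt (hg : Continuous g) (hpos : ∀ x, c < x → 0 < g x)
    (hneg : ∀ x, x < c → g x < 0) {m M : ℝ} (hm : m < c) (hM : c < M) {x : ℝ}
    (hxm : ∫ s in c..x, g s < ∫ s in c..m, g s) (hxM : ∫ s in c..x, g s < ∫ s in c..M, g s) :
    x ∈ Icc m M := by
  refine ⟨le_of_not_gt fun h => ?_, le_of_not_gt fun h => ?_⟩
  · exact lt_asymm hxm (strictAntiOn_integral_of_neg hg hneg (mem_Iic.2 (h.trans hm).le)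
      (mem_Iic.2 hm.le) h)
  · exact lt_asymm hxM (strictMonoOn_integral_of_pos hg hpos (mem_Ici.2 hM.le)
      (mem_Ici.2 (hM.trans h).le) h)

end Potential

/-- Conservation of energy for the Hamiltonian system `v' = k(w)`, `w' = -g(v)`. -/
theorem energy_eq {g k v w : ℝ → ℝ} (hg : Continuous g) (hk : Continuous k)
    (hv : ∀ t, HasDerivAt v (k (w t)) t) (hw : ∀ t, HasDerivAt w (-g (v t)) t) (c : ℝ) (t s : ℝ) :
    (∫ y in (0 : ℝ)..w t, k y) + ∫ y in c..v t, g y =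
      (∫ y in (0 : ℝ)..w s, k y) + ∫ y in c..v s, g y := by
  have h : ∀ t, HasDerivAt
      (fun t => (∫ y in (0 : ℝ)..w t, k y) + ∫ y in c..v t, g y) 0 t := fun t => by
    have h1 := (hasDerivAt_integral_of_continuous hk 0 (w t)).comp t (hw t)
    have h2 := (hasDerivAt_integral_of_continuous hg c (v t)).comp t (hv t)
    exact (h1.add h2).congr_deriv (by ring)
  exact is_const_of_deriv_eq_zero (fun t => (h t).differentiableAt) (fun t => (h t).deriv) t s

section Oscillator

variable {g v w : ℝ → ℝ} {c B : ℝ}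

/-- A bounded nonequilibrium solution of `v'' = -g(v)` cannot stay above `c`. -/
theorem exists_ge_lt_of_oscillator (hg : Continuous g) (hgc : g c = 0)
    (hpos : ∀ x, c < x → 0 < g x) (hv : ∀ t, HasDerivAt v (w t) t)
    (hw : ∀ t, HasDerivAt w (-g (v t)) t) (hB : ∀ t, v t ≤ B)
    (hne : ∀ t, v t = c → w t ≠ 0) (T : ℝ) : ∃ t ≥ T, v t < c := by
  by_contra! hvc
  have hgnn : ∀ t, T ≤ t → 0 ≤ g (v t) := fun t ht => by
    rcases (hvc t ht).eq_or_lt with h | h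
    · rw [← h, hgc]
    · exact (hpos _ h).le
  have hwanti : ∀ a, T ≤ a → ∀ t, a ≤ t → w t ≤ w a := fun a ha t hat => by
    have := HasDerivAt.image_sub_le_mul_sub_of_le hw (C := 0)
      (fun s hs => neg_nonpos.2 (hgnn s (ha.trans hs))) hat
    linarith
  have hwnn : ∀ t, T ≤ t → 0 ≤ w t := by
    intro a ha
    by_contra! hneg
    have hdiv : 0 ≤ (c - v a) / w a :=
      div_nonneg_of_nonpos (by linarith [hvc a ha]) hneg.le
    have h1 := HasDerivAt.image_sub_le_mul_sub_of_le hv (hwanti a ha)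
      (t := a + ((c - v a) / w a + 1)) (by linarith)
    have h2 := hvc (a + ((c - v a) / w a + 1)) (by linarith)
    have h3 : w a * ((c - v a) / w a) = c - v a := mul_div_cancel₀ _ hneg.ne
    have h4 : w a * (a + ((c - v a) / w a + 1) - a) = w a * ((c - v a) / w a) + w a := by ring
    linarith
  have hvmono : ∀ a, T ≤ a → ∀ t, a ≤ t → v a ≤ v t := fun a ha t hat => by
    have := HasDerivAt.image_sub_le_mul_sub_of_le (fun s => (hv s).neg) (C := 0)
      (fun s hs => neg_nonpos.2 (hwnn s (ha.trans hs))) hat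
    simp only [Pi.neg_apply] at this
    linarith
  by_cases hex : ∃ a ≥ T, c < v a
  · obtain ⟨a, ha, hca⟩ := hex
    obtain ⟨x₀, hx₀, hmin⟩ := isCompact_Icc.exists_isMinOn
      (nonempty_Icc.2 (hB a)) hg.continuousOn
    have hδ : 0 < g x₀ := hpos _ (hca.trans_le hx₀.1)
    have hle : 0 ≤ w a / g x₀ := div_nonneg (hwnn a ha) hδ.le
    have h1 := HasDerivAt.image_sub_le_mul_sub_of_le hw (C := -g x₀)
      (fun s hs => neg_le_neg (hmin ⟨hvmono a ha s hs, hB s⟩))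
      (t := a + (w a / g x₀ + 1)) (by linarith)
    have h2 := hwnn (a + (w a / g x₀ + 1)) (by linarith)
    have h3 : g x₀ * (w a / g x₀) = w a := mul_div_cancel₀ _ hδ.ne'
    have h4 : -g x₀ * (a + (w a / g x₀ + 1) - a) = -(g x₀ * (w a / g x₀)) - g x₀ := by ring
    linarith
  · push Not at hex
    have hveq : ∀ t, T ≤ t → v t = c := fun t ht => le_antisymm (hex t ht) (hvc t ht)
    have hev : v =ᶠ[nhds (T + 1)] fun _ => c := by
      filter_upwards [Ioi_mem_nhds (lt_add_one T)] with t ht using hveq t (mem_Ioi.1 ht).le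
    exact hne (T + 1) (hveq _ (by linarith))
      ((hv (T + 1)).unique ((hasDerivAt_const (T + 1) c).congr_of_eventuallyEq hev))

theorem exists_ge_gt_of_oscillator (hg : Continuous g) (hgc : g c = 0)
    (hneg : ∀ x, x < c → g x < 0) (hv : ∀ t, HasDerivAt v (w t) t)
    (hw : ∀ t, HasDerivAt w (-g (v t)) t) (hB : ∀ t, B ≤ v t)
    (hne : ∀ t, v t = c → w t ≠ 0) (T : ℝ) : ∃ t ≥ T, c < v t := by
  obtain ⟨t, ht, h⟩ := exists_ge_lt_of_oscillator (g := fun x => -g (-x)) (v := fun t => -v t)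
    (w := fun t => -w t) (c := -c) (B := -B) (by fun_prop) (by simp [hgc])
    (fun x hx => neg_pos.2 (hneg _ (by linarith))) (fun t => (hv t).neg)
    (fun t => by simpa only [neg_neg] using (hw t).fun_neg) (fun t => neg_le_neg (hB t))
    (fun t h => neg_ne_zero.2 (hne t (neg_injective h))) T
  exact ⟨t, ht, neg_lt_neg_iff.1 h⟩

/-- The velocity of an oscillating solution vanishes at arbitrarily large times. -/
theorem exists_ge_deriv_eq_zero_of_oscillating (hv : ∀ t, HasDerivAt v (w t) t)
    (hw : Continuous w) (hlt : ∀ T, ∃ t ≥ T, v t < c) (hgt : ∀ T, ∃ t ≥ T, c < v t) (T : ℝ) :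
    ∃ t ≥ T, w t = 0 := by
  by_contra! hne
  have hsign : (∀ t, T ≤ t → 0 ≤ w t) ∨ (∀ t, T ≤ t → w t ≤ 0) := by
    by_contra! h
    obtain ⟨⟨a, ha, hwa⟩, b, hb, hwb⟩ := h
    obtain ⟨t, ht, h0⟩ := isPreconnected_Ici.intermediate_value (mem_Ici.2 ha) (mem_Ici.2 hb)
      hw.continuousOn ⟨hwa.le, hwb.le⟩
    exact hne t ht h0
  rcases hsign with h | h
  · obtain ⟨a, ha, hca⟩ := hgt T
    obtain ⟨b, hb, hcb⟩ := hlt a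
    have := HasDerivAt.image_sub_le_mul_sub_of_le (fun s => (hv s).neg) (C := 0)
      (fun s hs => neg_nonpos.2 (h s (ha.trans hs))) hb
    simp only [Pi.neg_apply] at this
    linarith
  · obtain ⟨a, ha, hca⟩ := hlt T
    obtain ⟨b, hb, hcb⟩ := hgt a
    have := HasDerivAt.image_sub_le_mul_sub_of_le hv (C := 0)
      (fun s hs => h s (ha.trans hs)) hb
    linarith

end Oscillator

/-- A nonlinear oscillator `v'' = -g(v)`, with `g` bounded, Lipschitz and changing sign exactly
at `c`, has a bounded solution oscillating around `c` without limit at infinity. -/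
theorem exists_oscillating_solution {g : ℝ → ℝ} {K L : NNReal} {m c M : ℝ}
    (hg : LipschitzWith K g) (hL : ∀ x, |g x| ≤ L) (hpos : ∀ x, c < x → 0 < g x)
    (hneg : ∀ x, x < c → g x < 0) (hm : m < c) (hM : c < M) :
    ∃ v w : ℝ → ℝ, (∀ t, HasDerivAt v (w t) t) ∧ (∀ t, HasDerivAt w (-g (v t)) t) ∧
      (∀ t, v t ∈ Icc m M) ∧ (∀ T, ∃ t ≥ T, v t < c) ∧ (∀ T, ∃ t ≥ T, c < v t) ∧
      ¬ ∃ l, Tendsto v atTop (nhds l) := by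
  have hgcont := hg.continuous
  have hgc : g c = 0 := by
    refine le_antisymm ?_ ?_
    · exact le_of_tendsto (hgcont.continuousAt.mono_left nhdsWithin_le_nhds : Tendsto g
        (nhdsWithin c (Iio c)) _) (eventually_mem_nhdsWithin.mono fun x hx => (hneg x hx).le)
    · exact ge_of_tendsto (hgcont.continuousAt.mono_left nhdsWithin_le_nhds : Tendsto g
        (nhdsWithin c (Ioi c)) _) (eventually_mem_nhdsWithin.mono fun x hx => (hpos x hx).le)
  set k : ℝ → ℝ := fun y => max (-1) (min 1 y) with hk
  have hklip : LipschitzWith 1 k := (LipschitzWith.id.const_min 1).const_max (-1)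
  have hkcont := hklip.continuous
  have hkpos : ∀ y, 0 < y → 0 < k y := fun y hy => lt_max_of_lt_right (lt_min one_pos hy)
  have hkneg : ∀ y, y < 0 → k y < 0 := fun y hy => max_lt (by norm_num) (min_lt_of_right_lt hy)
  have hkid : ∀ y ∈ Icc (-1 : ℝ) 1, k y = y := fun y hy => by
    simp [hk, hy.1, hy.2]
  have hkbd : ∀ y, |k y| ≤ 1 := fun y =>
    abs_le.2 ⟨le_max_left _ _, max_le (by norm_num) (min_le_left _ _)⟩
  obtain ⟨x₀, hx₀c, hx₀⟩ : ∃ x₀, c < x₀ ∧ ∫ s in c..x₀, g s <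
      min (min (∫ s in c..m, g s) (∫ s in c..M, g s))
        (min (∫ s in (0 : ℝ)..(-1), k s) (∫ s in (0 : ℝ)..1, k s)) := by
    have hmin : (∫ s in c..c, g s) < min (min (∫ s in c..m, g s) (∫ s in c..M, g s))
        (min (∫ s in (0 : ℝ)..(-1), k s) (∫ s in (0 : ℝ)..1, k s)) := by
      rw [intervalIntegral.integral_same]
      exact lt_min (lt_min (integral_pos_of_ne hgcont hpos hneg hm.ne)
        (integral_pos_of_ne hgcont hpos hneg hM.ne'))
        (lt_min (integral_pos_of_ne hkcont hkpos hkneg (by norm_num))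
        (integral_pos_of_ne hkcont hkpos hkneg (by norm_num)))
    have hev := (hasDerivAt_integral_of_continuous hgcont c c).continuousAt.eventually_lt_const hmin
    obtain ⟨x, hx1, hx2⟩ := ((eventually_mem_nhdsWithin (a := c) (s := Ioi c)).and
      (hev.filter_mono nhdsWithin_le_nhds)).exists
    exact ⟨x, hx1, hx2⟩
  simp only [lt_min_iff] at hx₀
  obtain ⟨⟨h1, h2⟩, h3, h4⟩ := hx₀
  have hFlip : LipschitzWith (max 1 K) fun z : ℝ × ℝ => (k z.2, -g z.1) := by
    refine LipschitzWith.prodMk ?_ ?_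
    · simpa [Function.comp_def] using hklip.comp (LipschitzWith.prod_snd (α := ℝ) (β := ℝ))
    · have h := (hg.comp (LipschitzWith.prod_fst (α := ℝ) (β := ℝ))).neg
      rwa [mul_one] at h
  obtain ⟨α, hα0, hα⟩ := exists_forall_hasDerivAt_of_lipschitzWith_of_bounded hFlip
    (L := max 1 L) (fun z => by
      rw [Prod.norm_def]
      push_cast
      exact max_le_max (hkbd _) (by simpa using hL z.1)) (x₀, 0)
  have hv' : ∀ t, HasDerivAt (fun t => (α t).1) (k (α t).2) t := fun t => (hα t).fst
  have hw : ∀ t, HasDerivAt (fun t => (α t).2) (-g (α t).1) t := fun t => (hα t).snd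
  generalize hvdef : (fun t => (α t).1) = v at hv'
  generalize hwdef : (fun t => (α t).2) = w at hw
  have hve : ∀ t, (α t).1 = v t := fun t => congrFun hvdef t
  have hwe : ∀ t, (α t).2 = w t := fun t => congrFun hwdef t
  simp only [hve] at hw
  simp only [hwe] at hv'
  have hv0 : v 0 = x₀ := by rw [← hve, hα0]
  have hw0 : w 0 = 0 := by rw [← hwe, hα0]
  have hen : ∀ t, (∫ y in (0 : ℝ)..w t, k y) + ∫ y in c..v t, g y = ∫ y in c..x₀, g y :=
    fun t => by simpa [hv0, hw0] using energy_eq hgcont hkcont hv' hw c t 0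
  have hE : 0 < ∫ y in c..x₀, g y := integral_pos_of_ne hgcont hpos hneg hx₀c.ne'
  have hvmem : ∀ t, v t ∈ Icc m M := fun t => by
    have := integral_nonneg_of_sign hkcont hkpos hkneg (w t)
    exact mem_Icc_of_integral_lt hgcont hpos hneg hm hM (by linarith [hen t]) (by linarith [hen t])
  have hwmem : ∀ t, w t ∈ Icc (-1 : ℝ) 1 := fun t => by
    have := integral_nonneg_of_sign hgcont hpos hneg (v t)
    exact mem_Icc_of_integral_lt hkcont hkpos hkneg (by norm_num) (by norm_num)
      (by linarith [hen t]) (by linarith [hen t])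
  have hv : ∀ t, HasDerivAt v (w t) t := fun t => by
    have := hv' t
    rwa [hkid _ (hwmem t)] at this
  have hne : ∀ t, v t = c → w t ≠ 0 := fun t h1 h2 => by
    have := hen t
    simp only [h1, h2, intervalIntegral.integral_same] at this
    linarith
  have hlt := exists_ge_lt_of_oscillator hgcont hgc hpos hv hw (fun t => (hvmem t).2) hne
  have hgt := exists_ge_gt_of_oscillator hgcont hgc hneg hv hw (fun t => (hvmem t).1) hne
  refine ⟨v, w, hv, hw, hvmem, hlt, hgt, ?_⟩
  rintro ⟨l, hl⟩
  have hflt : ∃ᶠ t in atTop, v t ≤ c := frequently_atTop.2 fun T =>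
    (hlt T).imp fun t h => ⟨h.1, h.2.le⟩
  have hfgt : ∃ᶠ t in atTop, c ≤ v t := frequently_atTop.2 fun T =>
    (hgt T).imp fun t h => ⟨h.1, h.2.le⟩
  have hlc : l = c := le_antisymm (le_of_tendsto_of_frequently hl hflt)
    (ge_of_tendsto_of_frequently hl hfgt)
  subst hlc
  have hG : Tendsto (fun t => ∫ y in l..v t, g y) atTop (nhds (∫ y in l..l, g y)) :=
    ((hasDerivAt_integral_of_continuous hgcont l l).continuousAt.tendsto).comp hl
  rw [intervalIntegral.integral_same] at hG
  obtain ⟨T, hT⟩ := eventually_atTop.1 (hG.eventually_lt_const hE)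
  obtain ⟨t, ht, hwt⟩ := exists_ge_deriv_eq_zero_of_oscillating hv
    (continuous_iff_continuousAt.2 fun t => (hw t).continuousAt) hlt hgt T
  have h5 := hT t ht
  have h6 := hen t
  simp only [hwt, intervalIntegral.integral_same] at h6
  linarith

theorem contDiff_two_of_hasDerivAt {v w z : ℝ → ℝ} (hv : ∀ t, HasDerivAt v (w t) t)
    (hw : ∀ t, HasDerivAt w (z t) t) (hz : Continuous z) : ContDiff ℝ 2 v := by
  have hw1 : ContDiff ℝ 1 w := by
    rw [contDiff_one_iff_deriv, funext fun t => (hw t).deriv]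
    exact ⟨fun t => (hw t).differentiableAt, hz⟩
  rw [show (2 : WithTop ℕ∞) = 1 + 1 by norm_num, contDiff_succ_iff_deriv,
    funext fun t => (hv t).deriv]
  exact ⟨fun t => (hv t).differentiableAt, by simp, hw1⟩

theorem hasDerivAt_rpow_mul_comp_neg_log {y : ℝ → ℝ} {y' x : ℝ} (hx : 0 < x) (r : ℝ)
    (hy : HasDerivAt y y' (-Real.log x)) :
    HasDerivAt (fun x => x ^ r * y (-Real.log x))
      (x ^ (r - 1) * (r * y (-Real.log x) - y')) x := by
  have h1 : HasDerivAt (fun x => x ^ r) (r * x ^ (r - 1)) x :=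
    Real.hasDerivAt_rpow_const (Or.inl hx.ne')
  have h2 : HasDerivAt (fun x => y (-Real.log x)) (y' * -x⁻¹) x :=
    hy.comp x (Real.hasDerivAt_log hx.ne').neg
  refine (h1.mul h2).congr_deriv ?_
  have h3 : x ^ r = x ^ (r - 1) * x := by
    rw [← Real.rpow_add_one hx.ne', sub_add_cancel]
  rw [h3]
  field_simp
  ring

/-- The Emden-Fowler substitution `u(x) = √x v(-log x)`. -/
theorem isPosSol_of_emdenFowler {p σ : ℝ} (hσp : σ + p / 2 = -(3 / 2)) {v w : ℝ → ℝ}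
    (hp : 0 ≤ p) (hv : ∀ t, HasDerivAt v (w t) t)
    (hw : ∀ t, HasDerivAt w (v t / 4 - v t ^ p) t) (hpos : ∀ t, 0 < v t) :
    IsPosSol p σ (fun x => x ^ (1 / 2 : ℝ) * v (-Real.log x)) := by
  have hvc : Continuous v := continuous_iff_continuousAt.2 fun t => (hv t).continuousAt
  refine ⟨fun x hx => mul_pos (Real.rpow_pos_of_pos hx _) (hpos _), ?_, ?_⟩
  · have hC2 : ContDiff ℝ 2 v := contDiff_two_of_hasDerivAt hv hw
      ((hvc.div_const 4).sub (hvc.rpow_const fun _ => Or.inr hp))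
    intro x hx
    have hx0 : x ≠ 0 := (mem_Ioi.1 hx).ne'
    exact ((Real.contDiffAt_rpow_const_of_ne hx0).mul
      (hC2.contDiffAt.comp x (Real.contDiffAt_log.2 hx0).neg)).contDiffWithinAt
  · intro x hx
    have hx : 0 < x := hx
    have hd1 : ∀ y : ℝ, 0 < y → deriv (fun x => x ^ (1 / 2 : ℝ) * v (-Real.log x)) y =
        y ^ (1 / 2 - 1 : ℝ) * (fun t => 1 / 2 * v t - w t) (-Real.log y) := fun y hy =>
      (hasDerivAt_rpow_mul_comp_neg_log hy _ (hv _)).deriv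
    have hev : deriv (fun x => x ^ (1 / 2 : ℝ) * v (-Real.log x)) =ᶠ[nhds x]
        fun y => y ^ (1 / 2 - 1 : ℝ) * (fun t => 1 / 2 * v t - w t) (-Real.log y) := by
      filter_upwards [Ioi_mem_nhds hx] with y hy using hd1 y hy
    rw [hev.deriv_eq, (hasDerivAt_rpow_mul_comp_neg_log hx _
      (((hv _).const_mul _).fun_sub (hw _))).deriv, Real.mul_rpow (Real.rpow_nonneg hx.le _)
      (hpos _).le, ← Real.rpow_mul hx.le, ← mul_assoc, ← Real.rpow_add hx,
      show σ + 1 / 2 * p = 1 / 2 - 1 - 1 by linarith]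
    ring

theorem exists_truncated_emdenFowler {p c : ℝ} (hp : 1 < p) (hc : 0 < c)
    (hcp : c ^ (p - 1) = 1 / 4) :
    ∃ (g : ℝ → ℝ) (K L : NNReal), LipschitzWith K g ∧ (∀ x, |g x| ≤ L) ∧
      (∀ x, c < x → 0 < g x) ∧ (∀ x, x < c → g x < 0) ∧
      ∀ x ∈ Icc (c / 2) (2 * c), g x = x ^ p - x / 4 := by
  set φ : ℝ → ℝ := fun x => x ^ p - x / 4 with hφ
  set h : ℝ → ℝ := fun x => max (c / 2) (min (2 * c) x) with hh
  have hhlip : LipschitzWith 1 h := (LipschitzWith.id.const_min _).const_max _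
  have hmem : ∀ x, h x ∈ Icc (c / 2) (2 * c) := fun x =>
    ⟨le_max_left _ _, max_le (by linarith) (min_le_left _ _)⟩
  have hφ' : ∀ x ∈ Icc (c / 2) (2 * c),
      HasDerivWithinAt φ (p * x ^ (p - 1) - 1 / 4) (Icc (c / 2) (2 * c)) x := fun x hx =>
    ((Real.hasDerivAt_rpow_const (Or.inr hp.le)).sub
      ((hasDerivAt_id x).div_const 4)).hasDerivWithinAt
  have hcont : Continuous fun x : ℝ => p * x ^ (p - 1) - 1 / 4 :=
    (continuous_const.mul (continuous_id.rpow_const fun _ => Or.inr (by linarith))).sub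
      continuous_const
  obtain ⟨K, hK⟩ := isCompact_Icc.exists_bound_of_continuousOn
    (hcont.continuousOn (s := Icc (c / 2) (2 * c)))
  have hφlip : LipschitzOnWith K.toNNReal φ (Icc (c / 2) (2 * c)) :=
    (convex_Icc _ _).lipschitzOnWith_of_nnnorm_hasDerivWithin_le hφ' fun x hx =>
      NNReal.coe_le_coe.1 ((hK x hx).trans (Real.le_coe_toNNReal K))
  obtain ⟨L, hL⟩ := isCompact_Icc.exists_bound_of_continuousOn hφlip.continuousOn
  have hfac : ∀ x, 0 < x → φ x = x * (x ^ (p - 1) - c ^ (p - 1)) := fun x hx => by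
    have : x ^ p = x ^ (p - 1) * x := by rw [← Real.rpow_add_one hx.ne', sub_add_cancel]
    simp only [hφ, hcp, this]
    ring
  refine ⟨fun x => φ (h x), K.toNNReal, L.toNNReal, ?_, ?_, ?_, ?_, ?_⟩
  · have := hφlip.comp (hhlip.lipschitzOnWith (s := univ)) fun x _ => hmem x
    rw [mul_one] at this
    exact lipschitzOnWith_univ.1 this
  · exact fun x => (hL _ (hmem x)).trans (Real.le_coe_toNNReal L)
  · intro x hx
    have h1 : c < h x := lt_max_of_lt_right (lt_min (by linarith) hx)
    simp only [hfac _ (hc.trans h1)]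
    exact mul_pos (hc.trans h1)
      (sub_pos.2 (Real.rpow_lt_rpow hc.le h1 (by linarith)))
  · intro x hx
    have h0 : 0 < h x := (half_pos hc).trans_le (hmem x).1
    have h1 : h x < c := max_lt (by linarith) (min_lt_of_right_lt hx)
    simp only [hfac _ h0]
    exact mul_neg_of_pos_of_neg h0
      (sub_neg.2 (Real.rpow_lt_rpow h0.le h1 (by linarith)))
  · intro x hx
    have : h x = x := by simp [hh, hx.1, hx.2]
    simp only [this, hφ]

/-- **Theorem 5.6.** For `σ < -2`, `p > -1-σ` with `a = (2+σ)/(1-p) = 1/2`, there is a positive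
solution `u` of `-u'' = x^σ u^p` on `(0,+∞)` such that `u - u_a` changes sign infinitely many
times near `0`, `u/u_a` is bounded on `(0,+∞)`, but `u/u_a` has no limit as `x → 0⁺`. -/
theorem oscillating_solution_exists (p σ : ℝ) (hσ : σ < -2) (hp : -1 - σ < p)
    (ha : (2 + σ) / (1 - p) = 1 / 2) :
    ∃ u : ℝ → ℝ, IsPosSol p σ u ∧
      (∀ ε > (0 : ℝ),
        (∃ x ∈ Set.Ioo (0 : ℝ) ε, 0 < u x - uExplicit p σ x) ∧
        (∃ x ∈ Set.Ioo (0 : ℝ) ε, u x - uExplicit p σ x < 0)) ∧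
      (∃ M : ℝ, ∀ x ∈ Set.Ioi (0 : ℝ), |u x / uExplicit p σ x| ≤ M) ∧
      ¬ ∃ L : ℝ, Tendsto (fun x => u x / uExplicit p σ x)
        (nhdsWithin 0 (Set.Ioi 0)) (nhds L) := by
  have hp1 : 1 < p := by linarith
  have hσp : σ + p / 2 = -(3 / 2) := by
    rw [div_eq_iff (by linarith)] at ha
    linarith
  set c : ℝ := (1 / 4 : ℝ) ^ (1 / (p - 1)) with hcdef
  have hc : 0 < c := Real.rpow_pos_of_pos (by norm_num) _
  have hcp : c ^ (p - 1) = 1 / 4 := by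
    rw [hcdef, ← Real.rpow_mul (by norm_num), one_div_mul_cancel (by linarith), Real.rpow_one]
  have hexp : ∀ x, uExplicit p σ x = c * x ^ (1 / 2 : ℝ) := fun x => by
    rw [uExplicit, ha, hcdef]
    norm_num
  obtain ⟨g, K, L, hg, hL, hpos, hneg, hgeq⟩ := exists_truncated_emdenFowler hp1 hc hcp
  obtain ⟨v, w, hv, hw, hmem, hlt, hgt, hlim⟩ := exists_oscillating_solution hg hL hpos hneg
    (half_lt_self hc) (by linarith : c < 2 * c)
  have hratio : ∀ x : ℝ, 0 < x →
      x ^ (1 / 2 : ℝ) * v (-Real.log x) / uExplicit p σ x = v (-Real.log x) / c := fun x hx => by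
    rw [hexp, mul_comm c, mul_div_mul_left _ _ (Real.rpow_pos_of_pos hx _).ne']
  have hdiff : ∀ t : ℝ, Real.exp (-t) ^ (1 / 2 : ℝ) * v (-Real.log (Real.exp (-t))) -
      uExplicit p σ (Real.exp (-t)) = Real.exp (-t) ^ (1 / 2 : ℝ) * (v t - c) := fun t => by
    rw [hexp, Real.log_exp, neg_neg]
    ring
  have hsmall : ∀ ε > (0 : ℝ), ∀ t ≥ -Real.log ε + 1, Real.exp (-t) ∈ Ioo (0 : ℝ) ε :=
    fun ε hε t ht => ⟨Real.exp_pos _, (Real.lt_log_iff_exp_lt hε).1 (by linarith)⟩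
  have hroot : ∀ t : ℝ, 0 < Real.exp (-t) ^ (1 / 2 : ℝ) := fun t =>
    Real.rpow_pos_of_pos (Real.exp_pos _) _
  refine ⟨fun x => x ^ (1 / 2 : ℝ) * v (-Real.log x), ?_, ?_, ⟨2, ?_⟩, ?_⟩
  · refine isPosSol_of_emdenFowler hσp (by linarith) hv (fun t => ?_)
      fun t => (half_pos hc).trans_le (hmem t).1
    exact (hw t).congr_deriv (by rw [hgeq _ (hmem t)]; ring)
  · intro ε hε
    obtain ⟨t, ht, hct⟩ := hgt (-Real.log ε + 1)
    obtain ⟨s, hs, hcs⟩ := hlt (-Real.log ε + 1)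
    refine ⟨⟨Real.exp (-t), hsmall ε hε t ht, ?_⟩, ⟨Real.exp (-s), hsmall ε hε s hs, ?_⟩⟩
    · rw [hdiff]
      exact mul_pos (hroot t) (sub_pos.2 hct)
    · rw [hdiff]
      exact mul_neg_of_pos_of_neg (hroot s) (sub_neg.2 hcs)
  · intro x hx
    have hm := hmem (-Real.log x)
    rw [hratio x hx, abs_of_nonneg (div_nonneg ((half_pos hc).le.trans hm.1) hc.le),
      div_le_iff₀ hc]
    exact hm.2
  · rintro ⟨l, hl⟩
    have hexp0 : Tendsto (fun t : ℝ => Real.exp (-t)) atTop (nhdsWithin 0 (Ioi 0)) :=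
      Real.tendsto_exp_atBot_nhdsGT.comp tendsto_neg_atTop_atBot
    refine hlim ⟨l * c, ((hl.comp hexp0).mul_const c).congr fun t => ?_⟩
    simp only [Function.comp_apply]
    rw [hratio _ (Real.exp_pos _), Real.log_exp, neg_neg, div_mul_cancel₀ _ hc.ne']
end

section
/- (Sturm-type comparison) Let a < b, let ρ > 0 be a positive C¹ weight on [a,b], and let q₁, q₂ ∈ C([a,b]) with q₁ ≤ q₂ on (a,b). Suppose u, v ∈ C²([a,b]) satisfy (ρu')' + ρ q₁ u ≥ 0 and (ρv')' + ρ q₂ v ≤ 0 on (a,b), that u > 0 on (a,b) with u(b) = 0, that v(a)u'(a) - u(a)v'(a) ≥ 0 and v(a) ≥ 0, and that either v(a) > 0 or v'(a) > 0. Then either v has a zero in (a,b), or else q₁ ≡ q₂ on (a,b) and both u and v solve (ρw')' + ρ q₁ w = 0 on (a,b). -/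
open Set

/-- At a minimum point `x` over an interval, the one-sided derivative points inward. -/
lemma IsMinOn.sub_mul_derivWithin_Icc_nonneg {f : ℝ → ℝ} {a b x y : ℝ}
    (hmin : IsMinOn f (Set.Icc a b) x) (hf : DifferentiableWithinAt ℝ f (Set.Icc a b) x)
    (hx : x ∈ Set.Icc a b) (hy : y ∈ Set.Icc a b) :
    0 ≤ (y - x) * derivWithin f (Set.Icc a b) x := by
  have h := hmin.localize.hasFDerivWithinAt_nonneg hf.hasDerivWithinAt.hasFDerivWithinAt
    (sub_mem_posTangentConeAt_of_segment_subset ((convex_Icc a b).segment_subset hx hy))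
  simpa using h

/-- A continuous function without zeros in `(a,b)`, nonnegative at `a` and with positive value or
positive one-sided derivative there, is positive on `(a,b)`. -/
lemma pos_on_Ioo_of_ne_zero {f : ℝ → ℝ} {a b : ℝ} (hab : a < b)
    (hf : DifferentiableOn ℝ f (Set.Icc a b)) (hne : ∀ x ∈ Set.Ioo a b, f x ≠ 0)
    (ha : 0 ≤ f a) (ha' : 0 < f a ∨ 0 < derivWithin f (Set.Icc a b) a) :
    ∀ x ∈ Set.Ioo a b, 0 < f x := by
  have hcont := hf.continuousOn
  by_contra! hcon
  obtain ⟨c, hc, hfc⟩ := hcon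
  have hneg : ∀ x ∈ Set.Ioo a b, f x < 0 := by
    intro x hx
    by_contra! hfx
    obtain ⟨z, hz, hfz⟩ := isPreconnected_Ioo.intermediate_value hc hx
      (hcont.mono Set.Ioo_subset_Icc_self) ⟨hfc, hfx⟩
    exact hne z hz hfz
  have hnonpos : ∀ x ∈ Set.Icc a b, f x ≤ 0 := by
    rw [← closure_Ioo hab.ne] at hcont ⊢
    exact fun x hx => le_on_closure (fun y hy => (hneg y hy).le) hcont continuousOn_const hx
  have ha_mem := Set.left_mem_Icc.2 hab.le
  have hb_mem := Set.right_mem_Icc.2 hab.le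
  have hfa : f a = 0 := le_antisymm (hnonpos a ha_mem) ha
  have hmin : IsMinOn (-f) (Set.Icc a b) a := fun x hx => by
    simpa [hfa] using hnonpos x hx
  have h := hmin.sub_mul_derivWithin_Icc_nonneg (hf a ha_mem).neg ha_mem hb_mem
  rw [derivWithin.neg] at h
  have hd := ha'.resolve_left hfa.not_gt
  nlinarith [mul_pos (sub_pos.2 hab) hd]

/-- A `C¹` weight times the derivative of a `C²` function is differentiable. -/
lemma differentiableOn_mul_derivWithin_Icc {ρ f : ℝ → ℝ} {a b : ℝ} (hab : a < b)
    (hρ : ContDiffOn ℝ 1 ρ (Set.Icc a b)) (hf : ContDiffOn ℝ 2 f (Set.Icc a b)) :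
    DifferentiableOn ℝ (fun t => ρ t * derivWithin f (Set.Icc a b) t) (Set.Icc a b) :=
  (hρ.differentiableOn one_ne_zero).mul
    ((hf.derivWithin (m := 1) (uniqueDiffOn_Icc hab) (by norm_num)).differentiableOn one_ne_zero)

/-- **Lemma 5.7** (Sturm-type comparison). Given a positive `C¹` weight `ρ` on `[a,b]` and
`q₁ ≤ q₂`, if `(ρu')' + ρq₁u ≥ 0 ≥ (ρv')' + ρq₂v` on `(a,b)` with `u > 0` on `(a,b)`,
`u(b) = 0`, suitable boundary conditions at `a`, then `v` vanishes somewhere in `(a,b)` unless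
`q₁ ≡ q₂` and both `u` and `v` solve `(ρw')' + ρq₁w = 0`. -/
theorem sturm_comparison (a b : ℝ) (hab : a < b) (ρ q₁ q₂ u v : ℝ → ℝ)
    (hρ : ContDiffOn ℝ 1 ρ (Set.Icc a b)) (hρpos : ∀ x ∈ Set.Icc a b, 0 < ρ x)
    (hq₁ : ContinuousOn q₁ (Set.Icc a b)) (hq₂ : ContinuousOn q₂ (Set.Icc a b))
    (hq : ∀ x ∈ Set.Ioo a b, q₁ x ≤ q₂ x)
    (hu : ContDiffOn ℝ 2 u (Set.Icc a b)) (hv : ContDiffOn ℝ 2 v (Set.Icc a b))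
    (hineq_u : ∀ x ∈ Set.Ioo a b,
      0 ≤ derivWithin (fun t => ρ t * derivWithin u (Set.Icc a b) t) (Set.Icc a b) x +
        ρ x * q₁ x * u x)
    (hineq_v : ∀ x ∈ Set.Ioo a b,
      derivWithin (fun t => ρ t * derivWithin v (Set.Icc a b) t) (Set.Icc a b) x +
        ρ x * q₂ x * v x ≤ 0)
    (hupos : ∀ x ∈ Set.Ioo a b, 0 < u x) (hub : u b = 0)
    (hbdry : 0 ≤ v a * derivWithin u (Set.Icc a b) a - u a * derivWithin v (Set.Icc a b) a)
    (hva : 0 ≤ v a)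
    (hva' : 0 < v a ∨ 0 < derivWithin v (Set.Icc a b) a) :
    (∃ x ∈ Set.Ioo a b, v x = 0) ∨
    ((∀ x ∈ Set.Ioo a b, q₁ x = q₂ x) ∧
     (∀ x ∈ Set.Ioo a b,
       derivWithin (fun t => ρ t * derivWithin u (Set.Icc a b) t) (Set.Icc a b) x +
         ρ x * q₁ x * u x = 0 ∧
       derivWithin (fun t => ρ t * derivWithin v (Set.Icc a b) t) (Set.Icc a b) x +
         ρ x * q₁ x * v x = 0)) := by
  refine or_iff_not_imp_left.2 fun hzero => ?_
  push Not at hzero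
  have hu₁ := hu.differentiableOn two_ne_zero
  have hv₁ := hv.differentiableOn two_ne_zero
  have hvpos := pos_on_Ioo_of_ne_zero hab hv₁ hzero hva hva'
  have ha_mem := Set.left_mem_Icc.2 hab.le
  have hb_mem := Set.right_mem_Icc.2 hab.le
  set S := Set.Icc a b with hS
  set P := fun t => ρ t * derivWithin u S t with hP
  set Q := fun t => ρ t * derivWithin v S t with hQ
  have hP₁ : DifferentiableOn ℝ P S := differentiableOn_mul_derivWithin_Icc hab hρ hu
  have hQ₁ : DifferentiableOn ℝ Q S := differentiableOn_mul_derivWithin_Icc hab hρ hv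
  -- the weighted Wronskian
  set W := fun t => v t * P t - u t * Q t with hW
  have hWderiv : ∀ x ∈ S, HasDerivWithinAt W (v x * derivWithin P S x - u x * derivWithin Q S x)
      S x := by
    intro x hx
    refine (((hv₁ x hx).hasDerivWithinAt.mul (hP₁ x hx).hasDerivWithinAt).sub
      ((hu₁ x hx).hasDerivWithinAt.mul (hQ₁ x hx).hasDerivWithinAt)).congr_deriv ?_
    simp only [hP, hQ]
    ring
  have hterms : ∀ x ∈ Set.Ioo a b,
      0 ≤ v x * (derivWithin P S x + ρ x * q₁ x * u x) ∧
      0 ≤ u x * -(derivWithin Q S x + ρ x * q₂ x * v x) ∧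
      0 ≤ ρ x * (u x * v x) * (q₂ x - q₁ x) := by
    intro x hx
    have hux := hupos x hx
    have hvx := hvpos x hx
    have hρx := hρpos x (Set.Ioo_subset_Icc_self hx)
    exact ⟨mul_nonneg hvx.le (hineq_u x hx),
      mul_nonneg hux.le (neg_nonneg.2 (hineq_v x hx)),
      mul_nonneg (by positivity) (sub_nonneg.2 (hq x hx))⟩
  have hWmono : MonotoneOn W S := by
    refine monotoneOn_of_hasDerivWithinAt_nonneg (convex_Icc a b)
      (fun x hx => (hWderiv x hx).continuousWithinAt)
      (fun x hx => (hWderiv x (interior_subset hx)).mono interior_subset) fun x hx => ?_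
    rw [interior_Icc] at hx
    obtain ⟨h₁, h₂, h₃⟩ := hterms x hx
    linarith
  have hWa : 0 ≤ W a := by
    have h := mul_nonneg (hρpos a ha_mem).le hbdry
    simp only [hW, hP, hQ]
    linarith
  have hWb : W b ≤ 0 := by
    have hnonneg : ∀ f : ℝ → ℝ, ContinuousOn f S → (∀ x ∈ Set.Ioo a b, 0 < f x) →
        ∀ x ∈ S, 0 ≤ f x := by
      intro f hf hpos
      rw [hS, ← closure_Ioo hab.ne] at hf ⊢
      exact fun x hx => le_on_closure (fun y hy => (hpos y hy).le) continuousOn_const hf hx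
    have hmin : IsMinOn u S b := fun x hx => by
      simpa [hub] using hnonneg u hu.continuousOn hupos x hx
    have h := hmin.sub_mul_derivWithin_Icc_nonneg (hu₁ b hb_mem) hb_mem ha_mem
    have hub' : derivWithin u S b ≤ 0 := by
      by_contra! hlt
      exact (mul_neg_of_neg_of_pos (sub_neg.2 hab) hlt).not_ge h
    have hvb := hnonneg v hv.continuousOn hvpos b hb_mem
    simp only [hW, hP, hub, zero_mul, sub_zero]
    exact mul_nonpos_of_nonneg_of_nonpos hvb
      (mul_nonpos_of_nonneg_of_nonpos (hρpos b hb_mem).le hub')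
  have hWzero : ∀ x ∈ S, W x = 0 := fun x hx =>
    le_antisymm ((hWmono hx hb_mem hx.2).trans hWb) (hWa.trans (hWmono ha_mem hx hx.1))
  have hkey : ∀ x ∈ Set.Ioo a b, q₁ x = q₂ x ∧ derivWithin P S x + ρ x * q₁ x * u x = 0 ∧
      derivWithin Q S x + ρ x * q₁ x * v x = 0 := by
    intro x hx
    have hxS := Set.Ioo_subset_Icc_self hx
    have hux := hupos x hx
    have hvx := hvpos x hx
    have hρx := hρpos x hxS
    have hd : v x * derivWithin P S x - u x * derivWithin Q S x = 0 :=
      (uniqueDiffOn_Icc hab x hxS).eq_deriv _ (hWderiv x hxS)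
        ((hasDerivWithinAt_const x S (0 : ℝ)).congr hWzero (hWzero x hxS))
    obtain ⟨h₁, h₂, h₃⟩ := hterms x hx
    have e₁ : v x * (derivWithin P S x + ρ x * q₁ x * u x) = 0 := by linarith
    have e₂ : u x * -(derivWithin Q S x + ρ x * q₂ x * v x) = 0 := by linarith
    have e₃ : ρ x * (u x * v x) * (q₂ x - q₁ x) = 0 := by linarith
    have hqx : q₁ x = q₂ x :=
      (sub_eq_zero.1 ((mul_eq_zero.1 e₃).resolve_left (by positivity))).symm
    refine ⟨hqx, (mul_eq_zero.1 e₁).resolve_left hvx.ne', ?_⟩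
    rw [hqx]
    exact neg_eq_zero.1 ((mul_eq_zero.1 e₂).resolve_left hux.ne')
  exact ⟨fun x hx => (hkey x hx).1, fun x hx => (hkey x hx).2⟩
end

section
/- Assume σ < -2 and p > -1-σ (in particular p > 1). Then every positive solution u ∈ C([0,+∞)) ∩ C²((0,+∞)) of -u''(x) = x^σ u(x)^p on (0,+∞) satisfies lim_{x→0⁺} u(x) = 0; that is, u(0) = 0. -/
open Set Filter

/-- A concave function on `(0, δ)` does not tend to `+∞` at `0⁺`. -/
theorem ConcaveOn.not_tendsto_atTop_nhdsGT_zero {f : ℝ → ℝ} {δ : ℝ} (hδ : 0 < δ)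
    (hf : ConcaveOn ℝ (Ioo 0 δ) f) : ¬ Tendsto f (nhdsWithin 0 (Ioi 0)) atTop := by
  intro h
  set a := δ / 3 with ha
  set b := δ / 2 with hb
  set m := (f b - f a) / (b - a) with hm
  have ha0 : 0 < a := by positivity
  have hIoo : ∀ᶠ x in nhdsWithin (0 : ℝ) (Ioi 0), x ∈ Ioo 0 a := Ioo_mem_nhdsGT ha0
  obtain ⟨x, hfx, hx0, hxa⟩ := ((h.eventually_gt_atTop (f a + |m| * a)).and hIoo).exists
  have hslope := hf.slope_anti_adjacent (x := x) (y := a) (z := b)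
    ⟨hx0, by linarith⟩ ⟨by linarith, by linarith⟩ hxa (by linarith)
  rw [← hm, le_div_iff₀ (by linarith)] at hslope
  nlinarith [neg_abs_le m, abs_nonneg m]

/-- For `σ < -2` and `p > -1-σ`, every positive solution `u ∈ C([0,+∞)) ∩ C²((0,+∞))` of
`-u'' = x^σ u^p` on `(0,+∞)` satisfies `u(x) → 0` as `x → 0⁺`, i.e. `u(0) = 0`. -/
theorem solution_vanishes_at_origin (p σ : ℝ) (hσ : σ < -2) (hp : -1 - σ < p)
    (u : ℝ → ℝ)
    (hcont : ContinuousOn u (Set.Ici 0))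
    (hreg : ContDiffOn ℝ 2 u (Set.Ioi 0))
    (hpos : ∀ x ∈ Set.Ioi (0 : ℝ), 0 < u x)
    (heq : ∀ x ∈ Set.Ioi (0 : ℝ), -(deriv (deriv u) x) = x ^ σ * u x ^ p) :
    Tendsto u (nhdsWithin 0 (Set.Ioi 0)) (nhds 0) ∧ u 0 = 0 := by
  have hlim : Tendsto u (nhdsWithin 0 (Ioi 0)) (nhds (u 0)) :=
    (hcont 0 self_mem_Ici).mono_left (nhdsWithin_mono _ Ioi_subset_Ici_self)
  suffices h0 : u 0 = 0 by exact ⟨by rwa [h0] at hlim, h0⟩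
  have hnonneg : 0 ≤ u 0 :=
    ge_of_tendsto hlim (eventually_nhdsWithin_of_forall fun x hx => (hpos x hx).le)
  by_contra hne
  have hL : 0 < u 0 := lt_of_le_of_ne hnonneg (Ne.symm hne)
  have hev : ∀ᶠ x in nhdsWithin (0 : ℝ) (Ioi 0), u 0 / 2 < u x :=
    hlim.eventually_const_lt (by linarith)
  obtain ⟨ε, hε, hεu⟩ := (mem_nhdsGT_iff_exists_Ioo_subset).1 hev
  have hε : 0 < ε := hε
  set δ := min ε 1
  have hδ : 0 < δ := lt_min hε one_pos
  set c := (u 0 / 2) ^ p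
  have hc : 0 < c := Real.rpow_pos_of_pos (by linarith) p
  have hu1 : ∀ x ∈ Ioi (0 : ℝ), HasDerivAt u (deriv u x) x := fun x hx =>
    ((hreg.differentiableOn (by norm_num)).differentiableAt (Ioi_mem_nhds hx)).hasDerivAt
  have hu2 : ∀ x ∈ Ioi (0 : ℝ), HasDerivAt (deriv u) (deriv (deriv u) x) x := fun x hx =>
    (((hreg.deriv_of_isOpen (m := 1) isOpen_Ioi (by norm_num)).differentiableOn
      (by norm_num)).differentiableAt (Ioi_mem_nhds hx)).hasDerivAt
  have hd1 : ∀ x ∈ Ioi (0 : ℝ),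
      HasDerivAt (fun y => u y - c * Real.log y) (deriv u x - c * x⁻¹) x := fun x hx =>
    (hu1 x hx).sub ((Real.hasDerivAt_log (ne_of_gt hx)).const_mul c)
  have hd2 : ∀ x ∈ Ioi (0 : ℝ), HasDerivAt (fun y => deriv u y - c * y⁻¹)
      (deriv (deriv u) x - c * -(x ^ 2)⁻¹) x := fun x hx =>
    (hu2 x hx).sub ((hasDerivAt_inv (ne_of_gt hx)).const_mul c)
  have hconc : ConcaveOn ℝ (Ioo 0 δ) (fun y => u y - c * Real.log y) := by
    refine concaveOn_of_hasDerivWithinAt2_nonpos (convex_Ioo 0 δ)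
      (f' := fun y => deriv u y - c * y⁻¹)
      (f'' := fun x => deriv (deriv u) x - c * -(x ^ 2)⁻¹)
      (fun x hx => (hd1 x hx.1).continuousAt.continuousWithinAt) ?_ ?_ ?_ <;>
      rw [interior_Ioo] <;> intro x hx
    · exact (hd1 x hx.1).hasDerivWithinAt
    · exact (hd2 x hx.1).hasDerivWithinAt
    · have hx0 : 0 < x := hx.1
      have hux : u 0 / 2 < u x := hεu ⟨hx0, hx.2.trans_le (min_le_left _ _)⟩
      have hx1 : x ≤ 1 := hx.2.le.trans (min_le_right _ _)
      have hpow : (x ^ 2)⁻¹ ≤ x ^ σ := by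
        have := Real.rpow_le_rpow_of_exponent_ge hx0 hx1 hσ.le
        rwa [Real.rpow_neg hx0.le, Real.rpow_two] at this
      have hup : c ≤ u x ^ p :=
        Real.rpow_le_rpow (by linarith) hux.le (by linarith)
      have hmul := mul_le_mul hpow hup hc.le (Real.rpow_nonneg hx0.le σ)
      have := heq x hx0
      linarith
  refine hconc.not_tendsto_atTop_nhdsGT_zero hδ ?_
  simp only [sub_eq_add_neg]
  exact hlim.add_atTop (tendsto_neg_atBot_atTop.comp
    (Real.tendsto_log_nhdsGT_zero.const_mul_atBot hc))
end
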